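/- (Concentration lemma.) Let ℓ ≥ 1 and let A, B be independent random ℓ×ℓ real orthogonal matrices, each distributed according to the Haar probability measure on the orthogonal group O(ℓ). Then for every t > 0, the probability that max_{i,j} |(Aᵀ B)_{i j}| ≥ t is at most 4 · ℓ² · exp(−t² ℓ / 2). -/

import Mathlib

open Matrix MeasureTheory

/-- The Borel-type (pi) measurable-space structure on real matrices. -/
instance matrixMeasurableSpace {ℓ : ℕ} : MeasurableSpace (Matrix (Fin ℓ) (Fin ℓ) ℝ) :=
  inferInstanceAs (MeasurableSpace (Fin ℓ → Fin ℓ → ℝ))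

namespace Matrix.orthogonalGroup

variable {ℓ : ℕ}

lemma measurable_entry (i j : Fin ℓ) :
    Measurable fun A : Matrix.orthogonalGroup (Fin ℓ) ℝ => (A : Matrix (Fin ℓ) (Fin ℓ) ℝ) i j :=
  (measurable_pi_apply j).comp ((measurable_pi_apply i).comp measurable_subtype_coe)

lemma measurable_of_entry {α : Type*} [MeasurableSpace α]
    {f : α → Matrix.orthogonalGroup (Fin ℓ) ℝ}
    (h : ∀ i j, Measurable fun x => (f x : Matrix (Fin ℓ) (Fin ℓ) ℝ) i j) : Measurable f :=
  Measurable.subtype_mk (measurable_pi_lambda _ fun i => measurable_pi_lambda _ fun j => h i j)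

lemma measurable_const_mul (Q : Matrix.orthogonalGroup (Fin ℓ) ℝ) : Measurable (Q * ·) := by
  refine measurable_of_entry fun i j => ?_
  simp only [Submonoid.coe_mul, Matrix.mul_apply]
  exact Finset.measurable_sum _ fun k _ => (measurable_entry k j).const_mul _

/-- Every unit vector is a prescribed row of some orthogonal matrix. -/
lemma exists_row_eq (i : Fin ℓ) (u : Fin ℓ → ℝ) (hu : ∑ k, u k ^ 2 = 1) :
    ∃ Q : Matrix.orthogonalGroup (Fin ℓ) ℝ, (Q : Matrix (Fin ℓ) (Fin ℓ) ℝ) i = u := by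
  have hon : Orthonormal ℝ
      (({i} : Set (Fin ℓ)).domRestrict fun _ => (WithLp.toLp 2 u : EuclideanSpace ℝ (Fin ℓ))) := by
    refine ⟨fun _ => ?_, fun a b hab => (hab (Subsingleton.elim a b)).elim⟩
    simp [EuclideanSpace.norm_eq, Set.domRestrict, hu]
  obtain ⟨b, hb⟩ := hon.exists_orthonormalBasis_extension_of_card_eq (by simp)
  refine ⟨⟨Matrix.of fun k m => b k m, (Matrix.mem_orthogonalGroup_iff _ _).2 ?_⟩, ?_⟩
  · ext k m
    have := orthonormal_iff_ite.1 b.orthonormal m k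
    simp only [PiLp.inner_apply, RCLike.inner_apply, conj_trivial] at this
    simp [Matrix.mul_apply, this, Matrix.one_apply, eq_comm]
  · ext m
    simp [hb i rfl]

lemma sum_exp_sign_le (v : Fin ℓ → ℝ) (s : ℝ) (hv : ∑ k, v k ^ 2 = 1) :
    ∑ ε : Fin ℓ → Bool, Real.exp (s * ∑ k, (if ε k then 1 else -1) * v k) ≤
      2 ^ ℓ * Real.exp (s ^ 2 / 2) := by
  have h : ∑ ε : Fin ℓ → Bool, Real.exp (s * ∑ k, (if ε k then 1 else -1) * v k) =
      ∏ k, (2 * Real.cosh (s * v k)) := by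
    simp_rw [Finset.mul_sum, Real.exp_sum]
    rw [← Fintype.piFinset_univ,
      ← Finset.prod_univ_sum (fun _ => (Finset.univ : Finset Bool))
        (fun k (e : Bool) => Real.exp (s * ((if e then 1 else -1) * v k)))]
    refine Finset.prod_congr rfl fun k _ => ?_
    simp [Real.cosh_eq]
    ring
  rw [h, Finset.prod_mul_distrib]
  simp only [Finset.prod_const, Finset.card_univ, Fintype.card_fin]
  gcongr
  calc ∏ k, Real.cosh (s * v k) ≤ ∏ k, Real.exp ((s * v k) ^ 2 / 2) :=
        Finset.prod_le_prod (fun k _ => (Real.cosh_pos _).le) fun k _ => Real.cosh_le_exp_half_sq _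
    _ = Real.exp (s ^ 2 / 2) := by
        rw [← Real.exp_sum, ← Finset.sum_div]
        simp_rw [mul_pow]
        rw [← Finset.mul_sum, hv, mul_one]

variable (μ : Measure (Matrix.orthogonalGroup (Fin ℓ) ℝ)) [μ.IsMulLeftInvariant]

lemma lintegral_const_mul_eq (Q : Matrix.orthogonalGroup (Fin ℓ) ℝ)
    {f : Matrix.orthogonalGroup (Fin ℓ) ℝ → ENNReal} (hf : Measurable f) :
    ∫⁻ B, f (Q * B) ∂μ = ∫⁻ B, f B ∂μ := by
  rw [← lintegral_map hf (measurable_const_mul Q), map_mul_left_eq_self]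

lemma sum_sq_col (B : Matrix.orthogonalGroup (Fin ℓ) ℝ) (j : Fin ℓ) :
    ∑ k, (B : Matrix (Fin ℓ) (Fin ℓ) ℝ) k j ^ 2 = 1 := by
  have := congrFun (congrFun ((Matrix.mem_orthogonalGroup_iff' _ _).1 B.2) j) j
  simpa [Matrix.mul_apply, Matrix.star_eq_conjTranspose, sq] using this

variable [IsProbabilityMeasure μ]

/-- Entries of a Haar orthogonal matrix are subgaussian with variance proxy `1 / ℓ`. Averaging
over sign vectors `ε`, all of which have norm `√ℓ`, reduces this to `cosh x ≤ exp (x ^ 2 / 2)`. -/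
lemma lintegral_exp_entry_le (s : ℝ) (i j : Fin ℓ) :
    ∫⁻ B, ENNReal.ofReal (Real.exp (s * √ℓ * (B : Matrix (Fin ℓ) (Fin ℓ) ℝ) i j)) ∂μ ≤
      ENNReal.ofReal (Real.exp (s ^ 2 / 2)) := by
  have hpos : (0 : ℝ) < ℓ := by exact_mod_cast i.pos
  have hsqrt : √(ℓ : ℝ) ≠ 0 := (Real.sqrt_pos.2 hpos).ne'
  set I := ∫⁻ B, ENNReal.ofReal (Real.exp (s * √ℓ * (B : Matrix (Fin ℓ) (Fin ℓ) ℝ) i j)) ∂μ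
    with hI
  have hmeas (ε : Fin ℓ → Bool) : Measurable fun B : Matrix.orthogonalGroup (Fin ℓ) ℝ =>
      ENNReal.ofReal (Real.exp
        (s * ∑ k, (if ε k then 1 else -1) * (B : Matrix (Fin ℓ) (Fin ℓ) ℝ) k j)) :=
    ((Finset.measurable_sum _ fun k _ => (measurable_entry k j).const_mul _).const_mul
      s).exp.ennreal_ofReal
  have hrot (ε : Fin ℓ → Bool) : ∫⁻ B, ENNReal.ofReal (Real.exp
      (s * ∑ k, (if ε k then 1 else -1) * (B : Matrix (Fin ℓ) (Fin ℓ) ℝ) k j)) ∂μ = I := by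
    obtain ⟨Q, hQ⟩ := exists_row_eq i (fun k => (if ε k then 1 else -1) / √ℓ) (by
      simp [div_pow, ite_pow, hpos.ne'])
    rw [hI, ← lintegral_const_mul_eq μ Q
      ((measurable_entry i j).const_mul (s * √ℓ)).exp.ennreal_ofReal]
    refine lintegral_congr fun B => ?_
    congr 2
    rw [Submonoid.coe_mul, Matrix.mul_apply, hQ, mul_assoc, Finset.mul_sum _ _ (√(ℓ : ℝ))]
    congr 1
    refine Finset.sum_congr rfl fun k _ => ?_
    field_simp
  have hsum : 2 ^ ℓ * I ≤ 2 ^ ℓ * ENNReal.ofReal (Real.exp (s ^ 2 / 2)) := by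
    calc 2 ^ ℓ * I = ∑ ε : Fin ℓ → Bool, ∫⁻ B, ENNReal.ofReal (Real.exp
          (s * ∑ k, (if ε k then 1 else -1) * (B : Matrix (Fin ℓ) (Fin ℓ) ℝ) k j)) ∂μ := by
          simp_rw [hrot]
          simp
      _ = ∫⁻ B, ENNReal.ofReal (∑ ε : Fin ℓ → Bool, Real.exp
          (s * ∑ k, (if ε k then 1 else -1) * (B : Matrix (Fin ℓ) (Fin ℓ) ℝ) k j)) ∂μ := by
          rw [← lintegral_finsetSum _ fun ε _ => hmeas ε]
          simp_rw [ENNReal.ofReal_sum_of_nonneg fun _ _ => (Real.exp_pos _).le]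
      _ ≤ ∫⁻ _, ENNReal.ofReal (2 ^ ℓ * Real.exp (s ^ 2 / 2)) ∂μ :=
          lintegral_mono fun B =>
            ENNReal.ofReal_le_ofReal (sum_exp_sign_le _ s (sum_sq_col B j))
      _ = 2 ^ ℓ * ENNReal.ofReal (Real.exp (s ^ 2 / 2)) := by
          simp [ENNReal.ofReal_mul, ENNReal.ofReal_pow]
  exact (ENNReal.mul_le_mul_iff_right (by simp) (by simp)).1 hsum

lemma measure_le_mul_entry_le {σ : ℝ} (hσ : σ ^ 2 = 1) (t : ℝ) (ht : 0 ≤ t) (i j : Fin ℓ) :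
    μ {B | t ≤ σ * (B : Matrix (Fin ℓ) (Fin ℓ) ℝ) i j} ≤
      ENNReal.ofReal (Real.exp (-t ^ 2 * ℓ / 2)) := by
  have hsq : √(ℓ : ℝ) ^ 2 = ℓ := Real.sq_sqrt (Nat.cast_nonneg ℓ)
  set a := ENNReal.ofReal (Real.exp (t ^ 2 * ℓ)) with ha
  have ha0 : a ≠ 0 := by simp [ha, Real.exp_pos]
  have hmarkov := (mul_meas_ge_le_lintegral (μ := μ)
    ((measurable_entry i j).const_mul (σ * t * √ℓ * √ℓ)).exp.ennreal_ofReal a).trans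
    (lintegral_exp_entry_le μ (σ * t * √ℓ) i j)
  have hsub : {B : Matrix.orthogonalGroup (Fin ℓ) ℝ |
      t ≤ σ * (B : Matrix (Fin ℓ) (Fin ℓ) ℝ) i j} ⊆ {B | a ≤ ENNReal.ofReal
        (Real.exp (σ * t * √ℓ * √ℓ * (B : Matrix (Fin ℓ) (Fin ℓ) ℝ) i j))} := by
    intro B hB
    refine ENNReal.ofReal_le_ofReal (Real.exp_le_exp.2 ?_)
    have hB' : t ≤ σ * (B : Matrix (Fin ℓ) (Fin ℓ) ℝ) i j := hB
    calc t ^ 2 * ℓ = t * ℓ * t := by ring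
      _ ≤ t * ℓ * (σ * (B : Matrix (Fin ℓ) (Fin ℓ) ℝ) i j) := by gcongr
      _ = _ := by linear_combination (-t * σ * (B : Matrix (Fin ℓ) (Fin ℓ) ℝ) i j) * hsq
  refine (ENNReal.mul_le_mul_iff_right ha0 ENNReal.ofReal_ne_top).1
    (((mul_le_mul_right (measure_mono hsub) a).trans hmarkov).trans_eq ?_)
  rw [ha, ← ENNReal.ofReal_mul (Real.exp_pos _).le, ← Real.exp_add]
  congr 2
  rw [mul_pow, mul_pow, hσ, hsq]
  ring

lemma measure_le_abs_entry_le (t : ℝ) (ht : 0 ≤ t) (i j : Fin ℓ) :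
    μ {B | t ≤ |(B : Matrix (Fin ℓ) (Fin ℓ) ℝ) i j|} ≤
      2 * ENNReal.ofReal (Real.exp (-t ^ 2 * ℓ / 2)) := by
  rw [two_mul]
  have h1 := measure_le_mul_entry_le μ (σ := 1) (by norm_num) t ht i j
  have h2 := measure_le_mul_entry_le μ (σ := -1) (by norm_num) t ht i j
  refine (measure_mono fun B hB => ?_).trans ((measure_union_le _ _).trans (add_le_add h1 h2))
  simpa [le_abs] using hB

lemma prod_measure_le_abs_entry_le (t : ℝ) (ht : 0 ≤ t) (i j : Fin ℓ) :
    (μ.prod μ) {p | t ≤ |((p.1 : Matrix (Fin ℓ) (Fin ℓ) ℝ)ᵀ *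
        (p.2 : Matrix (Fin ℓ) (Fin ℓ) ℝ)) i j|} ≤
      2 * ENNReal.ofReal (Real.exp (-t ^ 2 * ℓ / 2)) := by
  have hmeas : MeasurableSet {p : Matrix.orthogonalGroup (Fin ℓ) ℝ ×
      Matrix.orthogonalGroup (Fin ℓ) ℝ | t ≤ |((p.1 : Matrix (Fin ℓ) (Fin ℓ) ℝ)ᵀ *
        (p.2 : Matrix (Fin ℓ) (Fin ℓ) ℝ)) i j|} := by
    simp only [Matrix.mul_apply, Matrix.transpose_apply]
    exact measurableSet_le measurable_const (measurable_norm.comp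
      (Finset.measurable_sum _ fun k _ => ((measurable_entry k i).comp measurable_fst).mul
        ((measurable_entry k j).comp measurable_snd)))
  rw [Measure.prod_apply hmeas]
  refine (lintegral_mono fun A => ?_).trans_eq (by rw [lintegral_const, measure_univ, mul_one])
  have hset : MeasurableSet {B : Matrix.orthogonalGroup (Fin ℓ) ℝ |
      t ≤ |(B : Matrix (Fin ℓ) (Fin ℓ) ℝ) i j|} :=
    measurableSet_le measurable_const (measurable_norm.comp (measurable_entry i j))
  refine le_of_eq_of_le ?_ (measure_le_abs_entry_le μ t ht i j)
  conv_rhs => rw [← map_mul_left_eq_self μ A⁻¹, Measure.map_apply (measurable_const_mul _) hset]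
  rfl

end Matrix.orthogonalGroup

/-- Concentration lemma: for `A`, `B` independent Haar-random `ℓ × ℓ` orthogonal
matrices (i.e. `(A, B)` distributed according to the product of the Haar probability
measure on `O(ℓ)` with itself), the probability that some entry of `Aᵀ B` has
absolute value at least `t` is at most `4 ℓ² exp(−t² ℓ / 2)`. -/
theorem haar_orthogonal_concentration {ℓ : ℕ} (hℓ : 1 ≤ ℓ)
    (μ : Measure (Matrix.orthogonalGroup (Fin ℓ) ℝ))
    [IsProbabilityMeasure μ] [μ.IsMulLeftInvariant]
    (t : ℝ) (ht : 0 < t) :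
    (μ.prod μ) {p : Matrix.orthogonalGroup (Fin ℓ) ℝ × Matrix.orthogonalGroup (Fin ℓ) ℝ |
        t ≤ ⨆ i, ⨆ j, |(((p.1 : Matrix (Fin ℓ) (Fin ℓ) ℝ))ᵀ *
              ((p.2 : Matrix (Fin ℓ) (Fin ℓ) ℝ))) i j|} ≤
      ENNReal.ofReal (4 * (ℓ : ℝ) ^ 2 * Real.exp (-t ^ 2 * ℓ / 2)) := by
  have : Nonempty (Fin ℓ) := ⟨⟨0, hℓ⟩⟩
  calc (μ.prod μ) _ ≤ (μ.prod μ) (⋃ i, ⋃ j,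
        {p : Matrix.orthogonalGroup (Fin ℓ) ℝ × Matrix.orthogonalGroup (Fin ℓ) ℝ |
          t ≤ |((p.1 : Matrix (Fin ℓ) (Fin ℓ) ℝ)ᵀ * (p.2 : Matrix (Fin ℓ) (Fin ℓ) ℝ)) i j|}) := by
        refine measure_mono fun p hp => ?_
        obtain ⟨i, hi⟩ := exists_eq_ciSup_of_finite (f := fun i => ⨆ j,
          |((p.1 : Matrix (Fin ℓ) (Fin ℓ) ℝ)ᵀ * (p.2 : Matrix (Fin ℓ) (Fin ℓ) ℝ)) i j|)
        obtain ⟨j, hj⟩ := exists_eq_ciSup_of_finite (f := fun j =>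
          |((p.1 : Matrix (Fin ℓ) (Fin ℓ) ℝ)ᵀ * (p.2 : Matrix (Fin ℓ) (Fin ℓ) ℝ)) i j|)
        exact Set.mem_iUnion₂.2 ⟨i, j, (hp.trans_eq hi.symm).trans_eq hj.symm⟩
    _ ≤ ∑ _i : Fin ℓ, ∑ _j : Fin ℓ, 2 * ENNReal.ofReal (Real.exp (-t ^ 2 * ℓ / 2)) :=
        (measure_iUnion_fintype_le _ _).trans <| Finset.sum_le_sum fun i _ =>
          (measure_iUnion_fintype_le _ _).trans <| Finset.sum_le_sum fun j _ =>
            Matrix.orthogonalGroup.prod_measure_le_abs_entry_le μ t ht.le i j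
    _ = ENNReal.ofReal (2 * (ℓ : ℝ) ^ 2 * Real.exp (-t ^ 2 * ℓ / 2)) := by
        rw [ENNReal.ofReal_mul (by positivity), ENNReal.ofReal_mul (by positivity),
          ENNReal.ofReal_pow (by positivity)]
        simp
        ring
    _ ≤ _ := ENNReal.ofReal_le_ofReal (by gcongr; norm_num)
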